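/- Let ε ∈ (0,1), δ ∈ (0,1), Δ > 0, k ∈ ℕ, and set σ = Δ·√(2·ln(1.25/δ))/ε. Let Y = (Y_1, …, Y_k) be i.i.d. real random variables, each with Gaussian distribution N(0, σ²). Then for all a, b ∈ ℝ^k with ‖a − b‖₂ ≤ Δ and every Borel set S ⊆ ℝ^k, Pr[a + Y ∈ S] ≤ e^ε · Pr[b + Y ∈ S] + δ. (Gaussian mechanism satisfies (ε,δ)-differential privacy.) -/

import Mathlib

open MeasureTheory Real ProbabilityTheory
open scoped ENNReal NNReal

lemma gaussianReal_eq_withDensity_exp (m : ℝ) {v : ℝ≥0} (hv : v ≠ 0) :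
    gaussianReal m v =
      (gaussianReal 0 v).withDensity (fun x ↦ ENNReal.ofReal (exp ((m * x - m ^ 2 / 2) / v))) := by
  have hv' : (v : ℝ) ≠ 0 := by exact_mod_cast hv
  rw [gaussianReal_of_var_ne_zero _ hv, gaussianReal_of_var_ne_zero _ hv,
    ← withDensity_mul _ (measurable_gaussianPDF 0 v) (by fun_prop)]
  congr 1
  ext x
  simp only [Pi.mul_apply, gaussianPDF]
  rw [← ENNReal.ofReal_mul (gaussianPDFReal_nonneg _ _ _)]
  congr 1
  simp only [gaussianPDFReal]
  rw [mul_assoc _ (exp _), ← exp_add]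
  congr 2
  field_simp
  ring

lemma pi_gaussianReal_eq_withDensity_exp {ι : Type*} [Fintype ι] (m : ι → ℝ) {v : ℝ≥0}
    (hv : v ≠ 0) :
    Measure.pi (fun i ↦ gaussianReal (m i) v) =
      (Measure.pi (fun _ : ι ↦ gaussianReal 0 v)).withDensity (fun x ↦
        ENNReal.ofReal (exp ((∑ i, m i * x i - (∑ i, m i ^ 2) / 2) / v))) := by
  refine Measure.pi_eq fun s hs ↦ ?_
  let f : ι → ℝ → ℝ≥0∞ := fun i ↦
    (s i).indicator fun t ↦ ENNReal.ofReal (exp ((m i * t - m i ^ 2 / 2) / v))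
  have hf : ∀ i, Measurable (f i) := fun i ↦
    Measurable.indicator (by fun_prop) (hs i)
  rw [withDensity_apply _ (MeasurableSet.univ_pi hs),
    ← lintegral_indicator (MeasurableSet.univ_pi hs)]
  have hprod : (Set.univ.pi s).indicator (fun x : ι → ℝ ↦
        ENNReal.ofReal (exp ((∑ i, m i * x i - (∑ i, m i ^ 2) / 2) / v))) =
      fun x ↦ ∏ i, f i (x i) := by
    ext x
    by_cases hx : x ∈ Set.univ.pi s
    · have hx' : ∀ i, x i ∈ s i := fun i ↦ hx i trivial
      simp only [Set.indicator_of_mem hx, f, Set.indicator_of_mem (hx' _)]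
      rw [← ENNReal.ofReal_prod_of_nonneg fun i _ ↦ (exp_pos _).le, ← exp_sum,
        ← Finset.sum_div, Finset.sum_sub_distrib, Finset.sum_div]
    · obtain ⟨i, hi⟩ : ∃ i, x i ∉ s i := by simpa using hx
      rw [Set.indicator_of_notMem hx, eq_comm]
      exact Finset.prod_eq_zero (Finset.mem_univ i) (Set.indicator_of_notMem hi _)
  rw [hprod]
  refine (lintegral_prod_eq_prod_lintegral_of_indepFun Finset.univ
    (fun i (x : ι → ℝ) ↦ f i (x i))
    (iIndepFun_pi (X := f) fun i ↦ (hf i).aemeasurable)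
    (fun i ↦ (hf i).comp (measurable_pi_apply i))).trans ?_
  refine Finset.prod_congr rfl fun i _ ↦ ?_
  rw [gaussianReal_eq_withDensity_exp (m i) hv, withDensity_apply _ (hs i),
    ← lintegral_indicator (hs i)]
  exact (measurePreserving_eval (fun _ : ι ↦ gaussianReal 0 v) i).lintegral_comp (hf i)

lemma map_const_add_pi_gaussianReal {ι : Type*} [Fintype ι] (m : ι → ℝ) (v : ℝ≥0) :
    (Measure.pi (fun _ : ι ↦ gaussianReal 0 v)).map (m + ·) =
      Measure.pi (fun i ↦ gaussianReal (m i) v) := by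
  have h := Measure.pi_map_pi (μ := fun _ : ι ↦ gaussianReal 0 v)
    (f := fun i x ↦ m i + x) (fun i ↦ by fun_prop)
  simp only [gaussianReal_map_const_add, zero_add] at h
  exact h

lemma map_sum_mul_pi_gaussianReal {ι : Type*} [Fintype ι] (m : ι → ℝ) (v : ℝ≥0) :
    (Measure.pi (fun _ : ι ↦ gaussianReal 0 v)).map (fun x ↦ ∑ i, m i * x i) =
      gaussianReal 0 (Real.toNNReal (∑ i, m i ^ 2) * v) := by
  have hmp := measurePreserving_eval (fun _ : ι ↦ gaussianReal 0 v)
  have hmem : ∀ i, MemLp (fun x ↦ m i * x) 2 (gaussianReal 0 v) := fun i ↦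
    (memLp_id_gaussianReal 2).const_mul (m i)
  have hmeas : ∀ i, Measurable (fun x : ι → ℝ ↦ m i * x i) := fun i ↦ by fun_prop
  have hmap : ∀ i, (Measure.pi (fun _ : ι ↦ gaussianReal 0 v)).map (fun x : ι → ℝ ↦ m i * x i) =
      (gaussianReal 0 v).map (m i * ·) := fun i ↦ by
    conv_rhs => rw [← (hmp i).map_eq, Measure.map_map (by fun_prop) (by fun_prop)]
    rfl
  have hlaw : ∀ i, HasGaussianLaw (fun x : ι → ℝ ↦ m i * x i)
      (Measure.pi (fun _ : ι ↦ gaussianReal 0 v)) := fun i ↦ by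
    constructor
    rw [hmap, gaussianReal_map_const_mul]
    infer_instance
  have hind : iIndepFun (fun i (x : ι → ℝ) ↦ m i * x i)
      (Measure.pi (fun _ : ι ↦ gaussianReal 0 v)) :=
    iIndepFun_pi (X := fun i x ↦ m i * x) fun i ↦ (measurable_const_mul (m i)).aemeasurable
  rw [(hind.hasGaussianLaw_fun_sum hlaw).map_eq_gaussianReal]
  congr 1
  · rw [integral_finsetSum _ fun i _ ↦ (hlaw i).integrable]
    refine Finset.sum_eq_zero fun i _ ↦ ?_
    have h := integral_map (μ := Measure.pi (fun _ : ι ↦ gaussianReal 0 v))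
      (φ := fun x : ι → ℝ ↦ m i * x i)
      (Measurable.aemeasurable (hmeas i)) (f := id)
      aestronglyMeasurable_id
    rw [hmap, gaussianReal_map_const_mul] at h
    simpa using h.symm
  · have h := variance_sum_pi hmem
    have hvar : ∀ i, Var[fun x ↦ m i * x; gaussianReal 0 v] = m i ^ 2 * v := fun i ↦ by
      rw [variance_const_mul, variance_fun_id_gaussianReal]
    simp only [hvar, ← Finset.sum_mul] at h
    have hfun : (fun x : ι → ℝ ↦ ∑ i, m i * x i) = ∑ i, fun x : ι → ℝ ↦ m i * x i := by
      ext x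
      simp
    rw [hfun, h, Real.toNNReal_mul (by positivity), Real.toNNReal_coe]

lemma gaussianReal_Ioi_zero_le (v : ℝ≥0) :
    gaussianReal 0 v (Set.Ioi 0) ≤ ENNReal.ofReal (1 / 2) := by
  have hneg : gaussianReal 0 v (Set.Iio 0) = gaussianReal 0 v (Set.Ioi 0) := by
    conv_lhs => rw [← neg_zero, ← gaussianReal_map_neg (μ := 0),
      Measure.map_apply (by fun_prop) measurableSet_Iio]
    simp
  have hdisj : Disjoint (Set.Iio (0 : ℝ)) (Set.Ioi 0) :=
    Set.disjoint_left.2 fun x hx hx' ↦ lt_asymm (Set.mem_Iio.1 hx) (Set.mem_Ioi.1 hx')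
  have hle : gaussianReal 0 v (Set.Iio 0) + gaussianReal 0 v (Set.Ioi 0) ≤ 1 := by
    rw [← measure_union hdisj measurableSet_Ioi]
    exact prob_le_one
  rw [hneg, ← two_mul] at hle
  rw [ENNReal.ofReal_div_of_pos two_pos, ENNReal.ofReal_one, ENNReal.ofReal_ofNat,
    ENNReal.le_div_iff_mul_le (by simp) (by simp), mul_comm]
  exact hle

lemma gaussianReal_Ioi_le_exp {t : ℝ} (ht : 0 ≤ t) :
    gaussianReal 0 1 (Set.Ioi t) ≤ ENNReal.ofReal (exp (-t ^ 2 / 2) / 2) := by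
  have hshift : gaussianReal 0 1 (Set.Ioi t) = gaussianReal (-t) 1 (Set.Ioi 0) := by
    rw [← zero_add (-t), ← gaussianReal_map_add_const,
      Measure.map_apply (by fun_prop) measurableSet_Ioi]
    congr 1
    ext x
    simp
  rw [hshift, gaussianReal_eq_withDensity_exp _ one_ne_zero, withDensity_apply _ measurableSet_Ioi]
  calc ∫⁻ x in Set.Ioi 0, ENNReal.ofReal (exp ((-t * x - (-t) ^ 2 / 2) / (1 : ℝ≥0)))
        ∂gaussianReal 0 1
      ≤ ∫⁻ _ in Set.Ioi 0, ENNReal.ofReal (exp (-t ^ 2 / 2)) ∂gaussianReal 0 1 := by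
        refine setLIntegral_mono (by fun_prop) fun x hx ↦ ?_
        refine ENNReal.ofReal_le_ofReal (exp_le_exp.2 ?_)
        have := mul_nonneg ht (le_of_lt hx)
        rw [NNReal.coe_one, div_one]
        linarith
    _ = ENNReal.ofReal (exp (-t ^ 2 / 2)) * gaussianReal 0 1 (Set.Ioi 0) := by
        rw [setLIntegral_const]
    _ ≤ ENNReal.ofReal (exp (-t ^ 2 / 2)) * ENNReal.ofReal (1 / 2) := by
        gcongr
        exact gaussianReal_Ioi_zero_le 1
    _ = ENNReal.ofReal (exp (-t ^ 2 / 2) / 2) := by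
        rw [← ENNReal.ofReal_mul (exp_pos _).le, mul_one_div]

lemma gaussianReal_Ioi_neg_le {s : ℝ} (hs : 0 ≤ s) :
    gaussianReal 0 1 (Set.Ioi (-s)) ≤ ENNReal.ofReal (1 / 2 + s) := by
  have hsub : Set.Ioi (-s) ⊆ Set.Ioc (-s) 0 ∪ Set.Ioi 0 := fun x hx ↦
    (le_or_gt x 0).imp (fun h ↦ ⟨hx, h⟩) id
  have hIoc : gaussianReal 0 1 (Set.Ioc (-s) 0) ≤ ENNReal.ofReal s := by
    rw [gaussianReal_apply _ one_ne_zero]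
    calc ∫⁻ x in Set.Ioc (-s) 0, gaussianPDF 0 1 x
        ≤ ∫⁻ _ in Set.Ioc (-s) 0, 1 := by
          refine lintegral_mono fun x ↦ ?_
          rw [gaussianPDF, ENNReal.ofReal_le_one, gaussianPDFReal]
          refine mul_le_one₀ (inv_le_one_of_one_le₀ (Real.one_le_sqrt.2 ?_)) (exp_pos _).le
            (exp_le_one_iff.2 ?_)
          · simp only [NNReal.coe_one]
            linarith [pi_gt_three]
          · rw [neg_div]
            exact neg_nonpos.2 (by positivity)
      _ = ENNReal.ofReal s := by simp
  calc gaussianReal 0 1 (Set.Ioi (-s))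
      ≤ gaussianReal 0 1 (Set.Ioc (-s) 0) + gaussianReal 0 1 (Set.Ioi 0) :=
        (measure_mono hsub).trans (measure_union_le _ _)
    _ ≤ ENNReal.ofReal s + ENNReal.ofReal (1 / 2) := by
        gcongr
        exact gaussianReal_Ioi_zero_le 1
    _ = ENNReal.ofReal (1 / 2 + s) := by
        rw [← ENNReal.ofReal_add hs (by norm_num), add_comm]

/-- The tail bound behind the calibration of the Gaussian mechanism, with
`c = √(2 log (1.25 / δ))`. -/
lemma gaussianReal_Ioi_le_of_calibration {ε δ c : ℝ} (hε : ε ∈ Set.Ioo (0 : ℝ) 1)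
    (hδ : δ ∈ Set.Ioo (0 : ℝ) 1) (hc : c = √(2 * log (1.25 / δ))) :
    gaussianReal 0 1 (Set.Ioi (c - ε / (2 * c))) ≤ ENNReal.ofReal δ := by
  obtain ⟨hε0, hε1⟩ := hε
  obtain ⟨hδ0, hδ1⟩ := hδ
  have hlog : 1 / 5 ≤ log (1.25 / δ) := by
    have h1 : log (1.25 : ℝ) ≤ log (1.25 / δ) :=
      log_le_log (by norm_num) ((le_div_iff₀ hδ0).2 (by linarith))
    have h2 := one_sub_inv_le_log_of_pos (x := (1.25 : ℝ)) (by norm_num)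
    norm_num at h1 h2 ⊢
    linarith
  have hcsq : c ^ 2 = 2 * log (1.25 / δ) := by rw [hc, sq_sqrt (by linarith)]
  have hc0 : 3 / 5 < c := by
    rw [hc]
    exact lt_sqrt_of_sq_lt (by linarith)
  have hδc : δ = 1.25 * exp (-c ^ 2 / 2) := by
    have : -c ^ 2 / 2 = -log (1.25 / δ) := by linarith
    rw [this, exp_neg, exp_log (by positivity)]
    field_simp
  rcases le_total 0 (c - ε / (2 * c)) with ht | ht
  · refine (gaussianReal_Ioi_le_exp ht).trans (ENNReal.ofReal_le_ofReal ?_)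
    have hsq : (c - ε / (2 * c)) ^ 2 = c ^ 2 - ε + (ε / (2 * c)) ^ 2 := by
      field_simp
      ring
    have hexp : exp (-(c - ε / (2 * c)) ^ 2 / 2) ≤ exp (1 / 2) * exp (-c ^ 2 / 2) := by
      rw [← exp_add, exp_le_exp, hsq]
      linarith [sq_nonneg (ε / (2 * c))]
    have hhalf : exp (1 / 2) ≤ 2.5 := by
      have h := exp_bound_div_one_sub_of_interval (x := 1 / 2) (by norm_num) (by norm_num)
      norm_num at h ⊢
      linarith
    rw [hδc]
    nlinarith [exp_pos (-c ^ 2 / 2)]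
  · have h := gaussianReal_Ioi_neg_le (s := -(c - ε / (2 * c))) (by linarith)
    rw [neg_neg] at h
    refine h.trans (ENNReal.ofReal_le_ofReal ?_)
    have hε' : 2 * c ^ 2 ≤ ε := by
      rw [sub_nonpos, le_div_iff₀ (by linarith)] at ht
      linarith
    have hδ' : 15 / 16 ≤ δ := by
      rw [hδc]
      have := add_one_le_exp (-c ^ 2 / 2)
      norm_num
      linarith
    have hs : ε / (2 * c) ≤ c + 7 / 16 := by
      rw [div_le_iff₀ (by linarith)]
      nlinarith
    linarith

/-- Likelihood-ratio form of the Gaussian mechanism: translating Gaussian noise by `m` costs a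
factor `exp ε`, up to the probability that the privacy loss exceeds `ε`. -/
lemma pi_gaussianReal_add_le {ι : Type*} [Fintype ι] (m : ι → ℝ) {v : ℝ≥0} (hv : v ≠ 0) (ε : ℝ)
    {T : Set (ι → ℝ)} (hT : MeasurableSet T) :
    Measure.pi (fun _ : ι ↦ gaussianReal 0 v) {y | m + y ∈ T} ≤
      ENNReal.ofReal (exp ε) * Measure.pi (fun _ : ι ↦ gaussianReal 0 v) T +
        gaussianReal 0 (Real.toNNReal (∑ i, m i ^ 2) * v)
          (Set.Ioi (ε * v - (∑ i, m i ^ 2) / 2)) := by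
  set μ := Measure.pi (fun _ : ι ↦ gaussianReal 0 v) with hμ
  have hv' : (0 : ℝ) < v := by positivity
  let L : (ι → ℝ) → ℝ := fun x ↦ (∑ i, m i * x i - (∑ i, m i ^ 2) / 2) / v
  have hL : Measurable L := by fun_prop
  have hmap : μ.map (m + ·) = μ.withDensity fun x ↦ ENNReal.ofReal (exp (L x)) := by
    rw [hμ, map_const_add_pi_gaussianReal, pi_gaussianReal_eq_withDensity_exp m hv]
  have hgood : MeasurableSet {x | L x ≤ ε} := measurableSet_le hL measurable_const
  have hbad : MeasurableSet {x | ε < L x} := measurableSet_lt measurable_const hL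
  have hsub : T ⊆ (T ∩ {x | L x ≤ ε}) ∪ {x | ε < L x} := fun x hx ↦
    (le_or_gt (L x) ε).imp (fun h ↦ ⟨hx, h⟩) id
  calc μ {y | m + y ∈ T}
      = μ.map (m + ·) T := (Measure.map_apply (by fun_prop) hT).symm
    _ ≤ μ.map (m + ·) (T ∩ {x | L x ≤ ε}) + μ.map (m + ·) {x | ε < L x} :=
        (measure_mono hsub).trans (measure_union_le _ _)
    _ ≤ _ := by
      refine add_le_add ?_ (le_of_eq ?_)
      · rw [hmap, withDensity_apply _ (hT.inter hgood)]
        calc ∫⁻ x in T ∩ {x | L x ≤ ε}, ENNReal.ofReal (exp (L x)) ∂μ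
            ≤ ∫⁻ _ in T ∩ {x | L x ≤ ε}, ENNReal.ofReal (exp ε) ∂μ :=
              setLIntegral_mono measurable_const fun x hx ↦
                ENNReal.ofReal_le_ofReal (exp_le_exp.2 hx.2)
          _ = ENNReal.ofReal (exp ε) * μ (T ∩ {x | L x ≤ ε}) := setLIntegral_const _ _
          _ ≤ ENNReal.ofReal (exp ε) * μ T := by
              gcongr
              exact Set.inter_subset_left
      · rw [Measure.map_apply (by fun_prop) hbad, ← map_sum_mul_pi_gaussianReal,
          Measure.map_apply (by fun_prop) measurableSet_Ioi]
        congr 1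
        ext y
        have hsum : ∑ i, m i * (m + y) i = ∑ i, m i ^ 2 + ∑ i, m i * y i := by
          rw [← Finset.sum_add_distrib]
          exact Finset.sum_congr rfl fun i _ ↦ by rw [Pi.add_apply]; ring
        simp only [Set.mem_preimage, Set.mem_ofPred_eq, Set.mem_Ioi, L, hsum, lt_div_iff₀ hv']
        constructor <;> intro h <;> linarith

lemma gaussianReal_Ioi_mul {r : ℝ} (hr : 0 < r) (t : ℝ) :
    gaussianReal 0 (Real.toNNReal (r ^ 2)) (Set.Ioi (r * t)) = gaussianReal 0 1 (Set.Ioi t) := by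
  have h := gaussianReal_map_const_mul (μ := 0) (v := 1) r
  have hr2 : NNReal.mk (r ^ 2) (sq_nonneg r) * 1 = Real.toNNReal (r ^ 2) := by
    rw [mul_one, Real.toNNReal_of_nonneg (sq_nonneg r)]
  rw [mul_zero, hr2] at h
  rw [← h, Measure.map_apply (by fun_prop) measurableSet_Ioi]
  congr 1
  ext x
  exact mul_lt_mul_iff_right₀ hr

/-- The Gaussian mechanism satisfies (ε,δ)-differential privacy: for ε, δ ∈ (0,1) and
σ = Δ·√(2·ln(1.25/δ))/ε, adding i.i.d. `N(0, σ²)` noise to any two vectors at ℓ₂-distance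
at most `Δ` yields output distributions satisfying the (ε,δ)-DP inequality on every Borel set. -/
theorem gaussian_mechanism_eps_delta_dp
    (ε δ Δ : ℝ) (hε : ε ∈ Set.Ioo (0:ℝ) 1) (hδ : δ ∈ Set.Ioo (0:ℝ) 1) (hΔ : 0 < Δ)
    (k : ℕ) (σ : ℝ) (hσ : σ = Δ * Real.sqrt (2 * Real.log (1.25 / δ)) / ε)
    (μ : Measure (Fin k → ℝ))
    (hμ : μ = Measure.pi (fun _ : Fin k => gaussianReal 0 (Real.toNNReal (σ ^ 2))))
    (a b : Fin k → ℝ) (hab : Real.sqrt (∑ i, (a i - b i) ^ 2) ≤ Δ)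
    (S : Set (Fin k → ℝ)) (hS : MeasurableSet S) :
    μ {y | a + y ∈ S} ≤ ENNReal.ofReal (Real.exp ε) * μ {y | b + y ∈ S}
      + ENNReal.ofReal δ := by
  set c := √(2 * log (1.25 / δ)) with hc
  have hc0 : 0 < c := by
    refine sqrt_pos.2 (mul_pos two_pos (log_pos ?_))
    rw [lt_div_iff₀ hδ.1]
    linarith [hδ.2]
  have hσ0 : 0 < σ := by
    have := hε.1
    rw [hσ]
    positivity
  set r := √(∑ i, (a i - b i) ^ 2) with hr
  have hr2 : ∑ i, (a - b) i ^ 2 = r ^ 2 :=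
    (sq_sqrt (Finset.sum_nonneg fun i _ ↦ sq_nonneg (a i - b i))).symm
  have hv : Real.toNNReal (σ ^ 2) ≠ 0 := by
    rw [Ne, Real.toNNReal_eq_zero, not_le]
    positivity
  have hvcoe : (Real.toNNReal (σ ^ 2) : ℝ) = σ ^ 2 := Real.coe_toNNReal _ (sq_nonneg σ)
  have hshift : {y | a + y ∈ S} = {y | (a - b) + y ∈ {z | b + z ∈ S}} := by
    ext y
    simp only [Set.mem_ofPred_eq, ← add_assoc, add_sub_cancel]
  have hT : MeasurableSet {z | b + z ∈ S} := (measurable_const_add b) hS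
  have hmain := pi_gaussianReal_add_le (a - b) hv ε hT
  rw [← hμ, ← hshift, hr2, hvcoe] at hmain
  refine hmain.trans (add_le_add le_rfl ?_)
  rcases (show 0 ≤ r from sqrt_nonneg _).eq_or_lt with hr0 | hr0
  · have : ε * σ ^ 2 > 0 := mul_pos hε.1 (by positivity)
    rw [show r = 0 from hr0.symm]
    simp [this.le]
  · replace hr0 : 0 < r := hr0
    rw [← Real.toNNReal_mul (sq_nonneg r), ← mul_pow,
      show ε * σ ^ 2 - r ^ 2 / 2 = r * σ * (ε * σ / r - r / (2 * σ)) by field_simp,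
      gaussianReal_Ioi_mul (by positivity)]
    refine (measure_mono (Set.Ioi_subset_Ioi ?_)).trans
      (gaussianReal_Ioi_le_of_calibration hε hδ hc)
    have hεσ : ε * σ = Δ * c := by
      rw [hσ]
      field_simp [hε.1.ne']
    have h1 : c ≤ ε * σ / r := by
      rw [le_div_iff₀ hr0, hεσ, mul_comm]
      gcongr
    have h2 : r / (2 * σ) ≤ ε / (2 * c) := by
      rw [div_le_div_iff₀ (by positivity) (by positivity)]
      nlinarith
    linarith
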